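/- Assume {u ∈ ℝ^J : Bu ≥ b} is nonempty and bounded. Let Γ ≥ 0, d_1,…,d_K ∈ ℝ^J, s ∈ {−1,1}^K, and x ∈ ℝ^J. Then, in the extended reals, inf{ u·x : u ∈ ℝ^J for which there exists ε ∈ ℝ^K with ε ≥ 0, Σ_κ ε_κ ≤ Γ, s_κ (u·d_κ) + ε_κ ≥ 0 for all κ, and Bu ≥ b } = sup{ b·β + Γμ : α ∈ ℝ^K with α ≥ 0, β ∈ ℝ^M with β ≥ 0, μ ∈ ℝ with μ ≤ 0, Σ_κ s_κ α_κ d_κ + Bᵀβ = x, and α_κ + μ ≤ 0 for all κ }. In particular, this strong linear-programming duality holds even when the primal feasible set is empty, in which case both sides equal +∞. -/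

import Mathlib

open scoped BigOperators

noncomputable section

/-- Farkas' lemma (Bartl's algebraic proof), functionals indexed by `Fin n`. -/
lemma farkas_fin {V : Type*} [AddCommGroup V] [Module ℝ V] (n : ℕ) :
    ∀ (a : Fin n → V →ₗ[ℝ] ℝ) (x : V →ₗ[ℝ] ℝ),
      (∀ v, (∀ i, 0 ≤ a i v) → 0 ≤ x v) →
      ∃ l : Fin n → ℝ, (∀ i, 0 ≤ l i) ∧ ∀ v, x v = ∑ i, l i * a i v := by
  induction n with
  | zero =>
    intro a x h
    refine ⟨fun _ => 0, fun _ => le_rfl, fun v => ?_⟩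
    have h1 := h v (fun i => i.elim0)
    have h2 := h (-v) (fun i => i.elim0)
    rw [map_neg] at h2
    simp
    linarith
  | succ n ih =>
    intro a x h
    by_cases hc : ∀ v, (∀ i : Fin n, 0 ≤ a i.succ v) → 0 ≤ x v
    · obtain ⟨l, hl, hx⟩ := ih (fun i => a i.succ) x hc
      refine ⟨Fin.cons 0 l, fun i => ?_, fun v => ?_⟩
      · refine Fin.cases ?_ (fun i => ?_) i
        · simp
        · simpa using hl i
      · simp [Fin.sum_univ_succ, hx v]
    · push Not at hc
      obtain ⟨w, hw, hxw⟩ := hc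
      have h0 : a 0 w < 0 := by
        by_contra hcon
        push Not at hcon
        have := h w (fun i => Fin.cases hcon hw i)
        linarith
      have hne : a 0 w ≠ 0 := h0.ne
      obtain ⟨l, hl, hx⟩ := ih (fun i => a i.succ - (a i.succ w / a 0 w) • a 0)
        (x - (x w / a 0 w) • a 0) (by
          intro v hv
          have := h (v - (a 0 v / a 0 w) • w) (fun i => by
            refine Fin.cases ?_ (fun i => ?_) i
            · simp [hne]
            · have := hv i
              simp only [LinearMap.sub_apply, LinearMap.smul_apply, smul_eq_mul, map_sub,
                map_smul] at this ⊢
              convert this using 2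
              ring)
          simp only [LinearMap.sub_apply, LinearMap.smul_apply, smul_eq_mul, map_sub,
            map_smul] at this ⊢
          convert this using 2
          ring)
      refine ⟨Fin.cons ((x w - ∑ i, l i * a i.succ w) / a 0 w) l, fun i => ?_, fun v => ?_⟩
      · refine Fin.cases ?_ (fun i => ?_) i
        · simp only [Fin.cons_zero]
          apply div_nonneg_of_nonpos _ h0.le
          have : 0 ≤ ∑ i, l i * a i.succ w :=
            Finset.sum_nonneg fun i _ => mul_nonneg (hl i) (hw i)
          linarith
        · simpa using hl i
      · have hv := hx v
        simp only [LinearMap.sub_apply, LinearMap.smul_apply, smul_eq_mul, mul_sub,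
          Finset.sum_sub_distrib] at hv
        have e : ∑ i, l i * (a i.succ w / a 0 w * a 0 v)
            = (∑ i, l i * a i.succ w) / a 0 w * a 0 v := by
          rw [Finset.sum_div, Finset.sum_mul]
          exact Finset.sum_congr rfl fun i _ => by ring
        rw [e] at hv
        simp only [Fin.sum_univ_succ, Fin.cons_zero, Fin.cons_succ]
        rw [sub_div, sub_mul]
        linarith

lemma farkas {V ι : Type*} [AddCommGroup V] [Module ℝ V] [Fintype ι]
    (a : ι → V →ₗ[ℝ] ℝ) (x : V →ₗ[ℝ] ℝ)
    (h : ∀ v, (∀ i, 0 ≤ a i v) → 0 ≤ x v) :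
    ∃ l : ι → ℝ, (∀ i, 0 ≤ l i) ∧ ∀ v, x v = ∑ i, l i * a i v := by
  classical
  let e := Fintype.equivFin ι
  obtain ⟨l, hl, hx⟩ := farkas_fin _ (fun i => a (e.symm i)) x
    (fun v hv => h v fun i => by simpa using hv (e i))
  refine ⟨fun i => l (e i), fun i => hl _, fun v => ?_⟩
  rw [hx v, ← e.sum_comp]
  simp

/-- A recession direction of a nonempty bounded polyhedron vanishes. -/
lemma recession_zero {J M : ℕ} (B : Matrix (Fin M) (Fin J) ℝ) (b : Fin M → ℝ)
    (hne : {u : Fin J → ℝ | ∀ m, b m ≤ B.mulVec u m}.Nonempty)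
    (hbd : Bornology.IsBounded {u : Fin J → ℝ | ∀ m, b m ≤ B.mulVec u m})
    (v : Fin J → ℝ) (hv : ∀ m, 0 ≤ B.mulVec v m) : v = 0 := by
  obtain ⟨u, hu⟩ := hne
  obtain ⟨R, hR⟩ := hbd.exists_norm_le
  by_contra hv0
  have hpos : 0 < ‖v‖ := norm_pos_iff.mpr hv0
  have hR0 : 0 ≤ R := (norm_nonneg _).trans (hR u hu)
  have hun := hR u hu
  set r : ℝ := (2 * R + 1) / ‖v‖ with hr
  have hr0 : 0 ≤ r := by positivity
  have hmem : u + r • v ∈ {u : Fin J → ℝ | ∀ m, b m ≤ B.mulVec u m} := by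
    intro m
    rw [Matrix.mulVec_add, Matrix.mulVec_smul]
    have := hu m
    have := mul_nonneg hr0 (hv m)
    simp only [Pi.add_apply, Pi.smul_apply, smul_eq_mul]
    linarith
  have h1 := hR _ hmem
  have h2 : ‖r • v‖ = 2 * R + 1 := by
    rw [norm_smul, Real.norm_of_nonneg hr0, hr]
    field_simp
  have h3 : ‖r • v‖ ≤ ‖u + r • v‖ + ‖u‖ := by
    have := norm_sub_le (u + r • v) u
    simpa using this
  linarith

abbrev LPVar (J K : ℕ) := (Fin J → ℝ) × (Fin K → ℝ) × ℝ

/-- The linear functional on `LPVar` with given coefficients. -/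
def lpFun {J K : ℕ} (c : Fin J → ℝ) (e : Fin K → ℝ) (r : ℝ) : LPVar J K →ₗ[ℝ] ℝ where
  toFun p := (∑ j, p.1 j * c j) + (∑ k, p.2.1 k * e k) + p.2.2 * r
  map_add' p q := by
    simp only [Prod.fst_add, Prod.snd_add, Pi.add_apply, add_mul, Finset.sum_add_distrib]
    ring
  map_smul' t p := by
    simp only [Prod.smul_fst, Prod.smul_snd, Pi.smul_apply, smul_eq_mul, RingHom.id_apply,
      mul_add, Finset.mul_sum, mul_assoc]

lemma lpFun_apply {J K : ℕ} (c : Fin J → ℝ) (e : Fin K → ℝ) (r : ℝ) (p : LPVar J K) :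
    lpFun c e r p = (∑ j, p.1 j * c j) + (∑ k, p.2.1 k * e k) + p.2.2 * r := rfl

lemma core {J M K : ℕ} (B : Matrix (Fin M) (Fin J) ℝ) (b : Fin M → ℝ)
    (hne : {u : Fin J → ℝ | ∀ m, b m ≤ B.mulVec u m}.Nonempty)
    (hbd : Bornology.IsBounded {u : Fin J → ℝ | ∀ m, b m ≤ B.mulVec u m})
    (Γ : ℝ) (d : Fin K → Fin J → ℝ)
    (s : Fin K → ℤ) (x : Fin J → ℝ) (c : ℝ)
    (hc : ∀ (u : Fin J → ℝ) (ε : Fin K → ℝ), (∀ κ, 0 ≤ ε κ) → (∑ κ, ε κ) ≤ Γ →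
      (∀ κ, 0 ≤ (s κ : ℝ) * (∑ j, u j * d κ j) + ε κ) → (∀ m, b m ≤ B.mulVec u m) →
      c ≤ ∑ j, u j * x j) :
    ∃ (α : Fin K → ℝ) (β : Fin M → ℝ) (μ : ℝ), (∀ κ, 0 ≤ α κ) ∧ (∀ m, 0 ≤ β m) ∧ μ ≤ 0 ∧
      (∀ j, (∑ κ, (s κ : ℝ) * α κ * d κ j) + (∑ m, B m j * β m) = x j) ∧
      (∀ κ, α κ + μ ≤ 0) ∧ c ≤ (∑ m, b m * β m) + Γ * μ := by
  classical
  obtain ⟨l, hl, hx⟩ := farkas (V := LPVar J K) (ι := (Fin K ⊕ Fin K) ⊕ (Fin M ⊕ Bool))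
    (Sum.elim
      (Sum.elim (fun k => lpFun 0 (Pi.single k 1) 0)
        (fun k => lpFun (fun j => (s k : ℝ) * d k j) (Pi.single k 1) 0))
      (Sum.elim (fun m => lpFun (fun j => B m j) 0 (- b m))
        (fun t => if t then lpFun 0 0 1 else lpFun 0 (fun _ => -1) Γ)))
    (lpFun x 0 (-c)) (by
      rintro ⟨u, ε, t⟩ h
      have h1 : ∀ k, 0 ≤ ε k := fun k => by
        simpa [lpFun_apply, Pi.single_apply] using h (.inl (.inl k))
      have h2 : ∀ k, 0 ≤ (s k : ℝ) * (∑ j, u j * d k j) + ε k := fun k => by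
        have := h (.inl (.inr k))
        simp [lpFun_apply, Pi.single_apply] at this
        rw [Finset.mul_sum]
        convert this using 2
        exact Finset.sum_congr rfl fun j _ => by ring
      have h3 : ∀ m, t * b m ≤ B.mulVec u m := fun m => by
        have := h (.inr (.inl m))
        simp [lpFun_apply] at this
        simp only [Matrix.mulVec, dotProduct]
        convert this using 1
        exact Finset.sum_congr rfl fun j _ => by ring
      have h4 : 0 ≤ t := by simpa [lpFun_apply] using h (.inr (.inr true))
      have h5 : ∑ k, ε k ≤ t * Γ := by
        have := h (.inr (.inr false))
        simp [lpFun_apply] at this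
        linarith
      have goal : t * c ≤ ∑ j, u j * x j := by
        rcases h4.eq_or_lt with h0 | hpos
        · have hu : u = 0 := recession_zero B b hne hbd u (fun m => by
            have := h3 m
            rw [← h0] at this
            simpa using this)
          simp [hu, ← h0]
        · have := hc (t⁻¹ • u) (t⁻¹ • ε)
            (fun k => by
              have := h1 k
              simp only [Pi.smul_apply, smul_eq_mul]; positivity)
            (by
              simp only [Pi.smul_apply, smul_eq_mul, ← Finset.mul_sum]
              rw [inv_mul_le_iff₀ hpos]; exact h5)
            (fun k => by
              have := mul_nonneg (inv_nonneg.mpr h4) (h2 k)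
              simp only [Pi.smul_apply, smul_eq_mul, mul_assoc, ← Finset.mul_sum]
              have e : t⁻¹ * ((s k : ℝ) * (∑ j, u j * d k j) + ε k)
                  = (s k : ℝ) * (t⁻¹ * ∑ j, u j * d k j) + t⁻¹ * ε k := by ring
              exact e ▸ this)
            (fun m => by
              rw [Matrix.mulVec_smul]
              simp only [Pi.smul_apply, smul_eq_mul]
              rw [le_inv_mul_iff₀ hpos]; exact h3 m)
          simp only [Pi.smul_apply, smul_eq_mul, mul_assoc, ← Finset.mul_sum] at this
          rwa [le_inv_mul_iff₀ hpos] at this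
      simp [lpFun_apply]
      linarith)
  refine ⟨fun k => l (.inl (.inr k)), fun m => l (.inr (.inl m)), - l (.inr (.inr false)),
    fun k => hl _, fun m => hl _, neg_nonpos.mpr (hl _), fun j => ?_, fun k => ?_, ?_⟩
  · have := hx (Pi.single j 1, 0, 0)
    simp [lpFun_apply, Pi.single_apply] at this
    rw [this]
    congr 1 <;> exact Finset.sum_congr rfl fun _ _ => by ring
  · have := hx (0, Pi.single k 1, 0)
    simp [lpFun_apply, Pi.single_apply] at this
    have := hl (.inl (.inl k))
    linarith
  · have := hx (0, 0, 1)
    simp [lpFun_apply] at this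
    have := hl (.inr (.inr true))
    have e : ∑ m, b m * l (.inr (.inl m)) = ∑ m, l (.inr (.inl m)) * b m :=
      Finset.sum_congr rfl fun _ _ => by ring
    rw [e]
    linarith

theorem inner_min_utility_strong_duality
    {J M K : ℕ} (B : Matrix (Fin M) (Fin J) ℝ) (b : Fin M → ℝ)
    (hne : {u : Fin J → ℝ | ∀ m, b m ≤ B.mulVec u m}.Nonempty)
    (hbd : Bornology.IsBounded {u : Fin J → ℝ | ∀ m, b m ≤ B.mulVec u m})
    (Γ : ℝ) (hΓ : 0 ≤ Γ) (d : Fin K → Fin J → ℝ)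
    (s : Fin K → ℤ) (hs : ∀ κ, s κ = -1 ∨ s κ = 1)
    (x : Fin J → ℝ) :
    (⨅ u ∈ {u : Fin J → ℝ | (∃ ε : Fin K → ℝ, (∀ κ, 0 ≤ ε κ) ∧ (∑ κ, ε κ) ≤ Γ ∧
          ∀ κ, 0 ≤ (s κ : ℝ) * (∑ j, u j * d κ j) + ε κ) ∧
          ∀ m, b m ≤ B.mulVec u m},
        ((∑ j, u j * x j : ℝ) : EReal))
      = ⨆ p ∈ {p : (Fin K → ℝ) × (Fin M → ℝ) × ℝ |
            (∀ κ, 0 ≤ p.1 κ) ∧ (∀ m, 0 ≤ p.2.1 m) ∧ p.2.2 ≤ 0 ∧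
            (∀ j, (∑ κ, (s κ : ℝ) * p.1 κ * d κ j) + (∑ m, B m j * p.2.1 m) = x j) ∧
            ∀ κ, p.1 κ + p.2.2 ≤ 0},
        (((∑ m, b m * p.2.1 m) + Γ * p.2.2 : ℝ) : EReal) := by
  apply le_antisymm
  · apply EReal.ge_of_forall_gt_iff_ge.mp
    intro c hc
    obtain ⟨α, β, μ, hα, hβ, hμ, heq, hle, hval⟩ := core B b hne hbd Γ d s x c
      (fun u ε h1 h2 h3 h4 => by
        have := hc.le.trans (iInf₂_le u ⟨⟨ε, h1, h2, h3⟩, h4⟩)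
        exact EReal.coe_le_coe_iff.mp this)
    refine (EReal.coe_le_coe_iff.mpr hval).trans ?_
    exact le_iSup₂_of_le (α, β, μ) ⟨hα, hβ, hμ, heq, hle⟩ le_rfl
  · refine iSup₂_le fun p hp => le_iInf₂ fun u hu => ?_
    obtain ⟨α, β, μ⟩ := p
    obtain ⟨hα, hβ, hμ, heq, hle⟩ := hp
    obtain ⟨⟨ε, hε, hsum, hd⟩, hB⟩ := hu
    simp only at hα hβ hμ heq hle ⊢
    rw [EReal.coe_le_coe_iff]
    have e1 : ∑ j, u j * x j
        = (∑ k, α k * ((s k : ℝ) * ∑ j, u j * d k j)) + ∑ m, β m * B.mulVec u m := by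
      simp only [← heq, mul_add, Finset.sum_add_distrib, Matrix.mulVec, dotProduct,
        Finset.mul_sum]
      congr 1
      · rw [Finset.sum_comm]
        exact Finset.sum_congr rfl fun _ _ => Finset.sum_congr rfl fun _ _ => by ring
      · rw [Finset.sum_comm]
        exact Finset.sum_congr rfl fun _ _ => Finset.sum_congr rfl fun _ _ => by ring
    have e2 : ∑ m, b m * β m ≤ ∑ m, β m * B.mulVec u m :=
      Finset.sum_le_sum fun m _ => by
        rw [mul_comm]; exact mul_le_mul_of_nonneg_left (hB m) (hβ m)
    have e3 : ∑ k, μ * ε k ≤ ∑ k, α k * ((s k : ℝ) * ∑ j, u j * d k j) :=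
      Finset.sum_le_sum fun k _ => by
        have h1 := mul_nonneg (hα k) (hd k)
        have h2 := mul_nonneg (hε k) (sub_nonneg.mpr (hle k))
        nlinarith
    rw [← Finset.mul_sum] at e3
    have e4 := mul_le_mul_of_nonpos_left hsum hμ
    linarith
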